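/- arXiv:1704.06891 — 2 statements merged into one kernel-verified Lean document; each statement's English description precedes it below -/
import Mathlib

section
/- Fix an integer p ≥ 2. For w₁, w₂ ∈ ℍ define θ₃(α; w₁, w₂) := Σ_{n∈α+ℤ²} (2n₁+n₂) e^{(3πi/2)(2n₁+n₂)² w₁ + (πi/2) n₂² w₂}. Then Σ_{α∈𝒮*} θ₃(α; w₁, w₂) = (1/p) Σ_{A∈𝒜} Θ₁(2p, A₁, 2p; 3w₁/p) Θ₀(2p, A₂, 2p; w₂/p), where 𝒜 := {(0,2), (p,p+2), (p−1,p−1), (−1,−1), (p+1,p−1), (1,−1)}. -/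
open Complex MeasureTheory Real Filter Topology

noncomputable section

/-- Shimura's theta function `Θ_ν(A,h,N;τ) = Σ_{m≡h (N)} m^ν e^{2πiτ·Am²/(2N²)}`. -/
def ShimTheta (ν : ℕ) (A : ℕ) (h : ℤ) (N : ℕ) (τ : ℂ) : ℂ :=
  ∑' m : ℤ, if (N : ℤ) ∣ (m - h) then
    (m : ℂ) ^ ν * Complex.exp (2 * Real.pi * Complex.I * τ * ((A : ℂ) * (m : ℂ) ^ 2 / (2 * (N : ℂ) ^ 2)))
  else 0

/-- `θ₃(α; w₁, w₂) = Σ_{n∈α+ℤ²} (2n₁+n₂) e^{(3πi/2)(2n₁+n₂)²w₁ + (πi/2)n₂²w₂}`. -/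
def theta3 (α : ℝ × ℝ) (w₁ w₂ : ℂ) : ℂ :=
  ∑' n : ℤ × ℤ,
    (((2 * (α.1 + n.1) + (α.2 + n.2)) : ℝ) : ℂ) *
      Complex.exp ((3 * Real.pi * Complex.I / 2) * (((2 * (α.1 + n.1) + (α.2 + n.2)) ^ 2 : ℝ) : ℂ) * w₁
        + (Real.pi * Complex.I / 2) * ((((α.2 + n.2)) ^ 2 : ℝ) : ℂ) * w₂)

/-- The set `𝒮*`, listed in order. -/
def Sstar (p : ℕ) : Fin 3 → ℝ × ℝ :=
  ![(1 - 1 / (p : ℝ), 2 / (p : ℝ)), (0, 1 - 1 / (p : ℝ)), (1 / (p : ℝ), 1 - 1 / (p : ℝ))]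

/-- The set `𝒜`, listed in order. -/
def Alist (p : ℕ) : Fin 6 → ℤ × ℤ :=
  ![(0, 2), ((p : ℤ), (p : ℤ) + 2), ((p : ℤ) - 1, (p : ℤ) - 1), (-1, -1),
    ((p : ℤ) + 1, (p : ℤ) - 1), (1, -1)]

/-- The summand of Shimura's theta function at the integer `m`. -/
def shimTerm (ν A N : ℕ) (τ : ℂ) (m : ℤ) : ℂ :=
  (m : ℂ) ^ ν * cexp (2 * π * I * τ * ((A : ℂ) * (m : ℂ) ^ 2 / (2 * (N : ℂ) ^ 2)))

theorem shimTheta_eq_tsum (ν A : ℕ) (h : ℤ) {N : ℕ} (hN : N ≠ 0) (τ : ℂ) :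
    ShimTheta ν A h N τ = ∑' k : ℤ, shimTerm ν A N τ (h + N * k) := by
  have hinj : Function.Injective fun k : ℤ ↦ h + N * k := fun a b hab ↦ by simpa [hN] using hab
  rw [ShimTheta, ← hinj.tsum_eq]
  · exact tsum_congr fun k ↦ by simp [shimTerm]
  · intro m hm
    by_cases hd : (N : ℤ) ∣ m - h
    · obtain ⟨k, hk⟩ := hd
      exact ⟨k, by simp only [← hk]; ring⟩
    · simp [hd] at hm

theorem shimTheta_add_modulus (ν A : ℕ) (h : ℤ) (N : ℕ) (τ : ℂ) :
    ShimTheta ν A (h + N) N τ = ShimTheta ν A h N τ := by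
  have hd (m : ℤ) : (N : ℤ) ∣ m - (h + N) ↔ (N : ℤ) ∣ m - h := by
    rw [← sub_sub, dvd_sub_self_right]
  simp only [ShimTheta, hd]

theorem summable_norm_shimTerm (ν : ℕ) {A N : ℕ} (hA : 0 < A) (hN : 0 < N) {τ : ℂ}
    (hτ : 0 < τ.im) : Summable fun m : ℤ ↦ ‖shimTerm ν A N τ m‖ := by
  have hT : 0 < (A : ℝ) / N ^ 2 * τ.im := by positivity
  refine (summable_pow_mul_jacobiTheta₂_term_bound 0 hT ν).congr fun m ↦ ?_
  have harg : 2 * π * I * τ * ((A : ℂ) * (m : ℂ) ^ 2 / (2 * (N : ℂ) ^ 2)) =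
      ((π * (A * m ^ 2 / N ^ 2) : ℝ) : ℂ) * (τ * I) := by
    push_cast
    ring
  rw [shimTerm, harg, norm_mul, norm_pow, Complex.norm_intCast, Complex.norm_exp,
    re_ofReal_mul, mul_I_re, Int.cast_abs]
  ring_nf

theorem summable_norm_shimTerm_progression (ν : ℕ) {A N : ℕ} (hA : 0 < A) (hN : 0 < N) {τ : ℂ}
    (hτ : 0 < τ.im) (h : ℤ) : Summable fun k : ℤ ↦ ‖shimTerm ν A N τ (h + N * k)‖ :=
  (summable_norm_shimTerm ν hA hN hτ).comp_injective
    (i := fun k : ℤ ↦ h + N * k) fun a b hab ↦ by simpa [hN.ne'] using hab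

theorem hasSum_shimTheta_mul (ν μ : ℕ) {A B N M : ℕ} (hA : 0 < A) (hB : 0 < B) (hN : 0 < N)
    (hM : 0 < M) (h l : ℤ) {τ σ : ℂ} (hτ : 0 < τ.im) (hσ : 0 < σ.im) :
    HasSum (fun k : ℤ × ℤ ↦ shimTerm ν A N τ (h + N * k.1) * shimTerm μ B M σ (l + M * k.2))
      (ShimTheta ν A h N τ * ShimTheta μ B l M σ) := by
  have h₁ := summable_norm_shimTerm_progression ν hA hN hτ h
  have h₂ := summable_norm_shimTerm_progression μ hB hM hσ l
  rw [shimTheta_eq_tsum ν A h hN.ne', shimTheta_eq_tsum μ B l hM.ne',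
    tsum_mul_tsum_of_summable_norm h₁ h₂]
  exact (summable_mul_of_summable_norm h₁ h₂).hasSum

/-- Summation over `ℤ × ℤ` according to the parity of the second coordinate `n₂`,
parametrised by the halves of `2 * n₁ + n₂` and `n₂`. -/
theorem HasSum.int_prod_even_add_odd {E : Type*} [AddCommMonoid E] [TopologicalSpace E]
    [ContinuousAdd E] {f : ℤ × ℤ → E} {a b : E}
    (he : HasSum (fun k : ℤ × ℤ ↦ f (k.1 - k.2, 2 * k.2)) a)
    (ho : HasSum (fun k : ℤ × ℤ ↦ f (k.1 - k.2, 2 * k.2 + 1)) b) : HasSum f (a + b) := by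
  have hi₀ : Function.Injective fun k : ℤ × ℤ ↦ (k.1 - k.2, 2 * k.2) := by
    rintro ⟨a, b⟩ ⟨c, d⟩ h
    simp only [Prod.mk.injEq] at h ⊢
    omega
  have hi₁ : Function.Injective fun k : ℤ × ℤ ↦ (k.1 - k.2, 2 * k.2 + 1) := by
    rintro ⟨a, b⟩ ⟨c, d⟩ h
    simp only [Prod.mk.injEq] at h ⊢
    omega
  refine (hi₀.hasSum_range_iff.2 he).add_isCompl ⟨?_, ?_⟩ (hi₁.hasSum_range_iff.2 ho)
  · rw [Set.disjoint_left]
    rintro _ ⟨⟨a, b⟩, rfl⟩ ⟨⟨c, d⟩, h⟩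
    simp only [Prod.mk.injEq] at h
    omega
  · rw [codisjoint_iff_le_sup]
    rintro ⟨x, y⟩ -
    obtain ⟨k, hk | hk⟩ := Int.even_or_odd' y
    · exact Or.inl ⟨(x + k, k), by simp [hk]⟩
    · exact Or.inr ⟨(x + k, k), by simp [hk]⟩

theorem theta3_summand_eq {p : ℕ} (hp : 0 < p) {x y : ℝ} {m n : ℤ} (hx : p * x = m)
    (hy : p * y = n) (w₁ w₂ : ℂ) :
    (x : ℂ) * cexp ((3 * π * I / 2) * ((x ^ 2 : ℝ) : ℂ) * w₁ +
        (π * I / 2) * ((y ^ 2 : ℝ) : ℂ) * w₂) =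
      1 / (p : ℂ) * (shimTerm 1 (2 * p) (2 * p) (3 * w₁ / p) m *
        shimTerm 0 (2 * p) (2 * p) (w₂ / p) n) := by
  have hp' : (p : ℂ) ≠ 0 := by exact_mod_cast hp.ne'
  have hm : (m : ℂ) = p * x := by exact_mod_cast hx.symm
  have hn : (n : ℂ) = p * y := by exact_mod_cast hy.symm
  rw [shimTerm, shimTerm, hm, hn, pow_one, pow_zero, one_mul, mul_assoc (_ * _), ← Complex.exp_add,
    ← mul_assoc, one_div, inv_mul_cancel_left₀ hp']
  congr 2
  push_cast
  field_simp

theorem theta3_eq_shimTheta {p : ℕ} (hp : 0 < p) {α : ℝ × ℝ} {a b : ℤ}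
    (ha : p * (2 * α.1 + α.2) = a) (hb : p * α.2 = b) {w₁ w₂ : ℂ}
    (h₁ : 0 < w₁.im) (h₂ : 0 < w₂.im) :
    theta3 α w₁ w₂ = 1 / (p : ℂ) *
      (ShimTheta 1 (2 * p) a (2 * p) (3 * w₁ / p) * ShimTheta 0 (2 * p) b (2 * p) (w₂ / p) +
        ShimTheta 1 (2 * p) (a + p) (2 * p) (3 * w₁ / p) *
          ShimTheta 0 (2 * p) (b + p) (2 * p) (w₂ / p)) := by
  have hτ : 0 < (3 * w₁ / p).im := by
    rw [Complex.div_natCast_im]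
    have : (3 * w₁).im = 3 * w₁.im := by simp
    rw [this]
    positivity
  have hσ : 0 < (w₂ / p).im := by
    rw [Complex.div_natCast_im]
    positivity
  have hp₂ : 0 < 2 * p := by positivity
  have hS (c d : ℤ) := (hasSum_shimTheta_mul 1 0 hp₂ hp₂ hp₂ hp₂ c d hτ hσ).mul_left (1 / (p : ℂ))
  rw [mul_add]
  refine (HasSum.int_prod_even_add_odd ((hS a b).congr_fun fun k ↦ ?_)
    ((hS (a + p) (b + p)).congr_fun fun k ↦ ?_)).tsum_eq
  all_goals
    apply theta3_summand_eq hp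
    · push_cast
      linear_combination ha
    · push_cast
      linear_combination hb

/-- Splitting of `Σ_{α∈𝒮*} θ₃(α;·)` into products of Shimura theta functions. -/
theorem theta3_shimura_splitting (p : ℕ) (hp : 2 ≤ p) (w₁ w₂ : ℂ)
    (h₁ : 0 < w₁.im) (h₂ : 0 < w₂.im) :
    ∑ i : Fin 3, theta3 (Sstar p i) w₁ w₂ =
      (1 / (p : ℂ)) * ∑ i : Fin 6,
        ShimTheta 1 (2 * p) (Alist p i).1 (2 * p) (3 * w₁ / p) *
        ShimTheta 0 (2 * p) (Alist p i).2 (2 * p) (w₂ / p) := by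
  have hp₀ : 0 < p := by omega
  have hpr : (p : ℝ) ≠ 0 := by exact_mod_cast hp₀.ne'
  have e₀ := theta3_eq_shimTheta hp₀ (α := Sstar p 0) (a := 0 + (2 * p : ℕ)) (b := 2)
    (by simp [Sstar]; field_simp; ring) (by simp [Sstar]; field_simp) h₁ h₂
  have e₁ := theta3_eq_shimTheta hp₀ (α := Sstar p 1) (a := -1 + p) (b := -1 + p)
    (by simp [Sstar]; field_simp; ring) (by simp [Sstar]; field_simp; ring) h₁ h₂
  have e₂ := theta3_eq_shimTheta hp₀ (α := Sstar p 2) (a := p + 1) (b := -1 + p)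
    (by simp [Sstar]; field_simp; ring) (by simp [Sstar]; field_simp; ring) h₁ h₂
  have r₀ : (0 + (2 * p : ℕ) + p : ℤ) = p + (2 * p : ℕ) := by ring
  have r₁ : (-1 + p + p : ℤ) = -1 + (2 * p : ℕ) := by push_cast; ring
  have r₂ : (p + 1 + p : ℤ) = 1 + (2 * p : ℕ) := by push_cast; ring
  rw [r₀, shimTheta_add_modulus, shimTheta_add_modulus] at e₀
  rw [r₁, shimTheta_add_modulus, shimTheta_add_modulus] at e₁
  rw [r₁, r₂, shimTheta_add_modulus, shimTheta_add_modulus] at e₂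
  rw [Fin.sum_univ_three, e₀, e₁, e₂]
  simp only [Fin.sum_univ_six, Alist]
  simp only [Matrix.cons_val, neg_add_eq_sub, add_comm (2 : ℤ)]
  ring

end
end

section
/- Let τ ∈ ℍ with v := Im τ, and let n₁, n₂ ∈ ℝ with n₁ ≠ 0, n₂ ≠ 0, 2n₁+n₂ ≠ 0 and 3n₁+2n₂ ≠ 0. Then M₂(√3; √(3v)(2n₁+n₂), √v·n₂) = −(√3/2)(2n₁+n₂)n₂ e^{2πiτQ(n₁,n₂)} ∫_{−τ̄}^{i∞} (−i(w₁+τ))^{−1/2} e^{(3πi/2)(2n₁+n₂)²w₁} (∫_{w₁}^{i∞} (−i(w₂+τ))^{−1/2} e^{(πi/2)n₂²w₂} dw₂) dw₁ − (√3/2)(3n₁+2n₂)n₁ e^{2πiτQ(n₁,n₂)} ∫_{−τ̄}^{i∞} (−i(w₁+τ))^{−1/2} e^{(πi/2)(3n₁+2n₂)²w₁} (∫_{w₁}^{i∞} (−i(w₂+τ))^{−1/2} e^{(3πi/2)n₁²w₂} dw₂) dw₁, where the outer integrals run along the upward vertical ray w₁ = −τ̄ + is (s ∈ [0,∞)), the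 inner integrals along the upward vertical ray w₂ = w₁ + is (s ∈ [0,∞)), and all square roots are principal branches. -/
open Complex MeasureTheory Real Filter Topology

noncomputable section

/-- The quadratic form `Q(x₁,x₂) = 3x₁² + 3x₁x₂ + x₂²`. -/
def Qf (x₁ x₂ : ℝ) : ℝ := 3 * x₁ ^ 2 + 3 * x₁ * x₂ + x₂ ^ 2

/-- `E(u) := 2∫₀ᵘ e^{−πw²} dw`. -/
def Efun (u : ℝ) : ℝ := 2 * ∫ w in (0:ℝ)..u, Real.exp (-Real.pi * w ^ 2)

/-- `M(u) := E(u) − sgn(u)`. -/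
def Mfun (u : ℝ) : ℝ := Efun u - Real.sign u

/-- `E₂(κ; u₁, u₂) := ∫_{ℝ²} sgn(w₁) sgn(w₂ + κw₁) e^{−π((w₁−u₁)² + (w₂−u₂)²)} dw₁ dw₂`. -/
def E2 (κ u₁ u₂ : ℝ) : ℝ :=
  ∫ w : ℝ × ℝ, Real.sign w.1 * Real.sign (w.2 + κ * w.1) *
    Real.exp (-Real.pi * ((w.1 - u₁) ^ 2 + (w.2 - u₂) ^ 2))

/-- `M₂(κ; u₁, u₂)`. -/
def M2 (κ u₁ u₂ : ℝ) : ℝ :=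
  E2 κ u₁ u₂ - Real.sign u₂ * Mfun u₁
    - Real.sign (u₁ - κ * u₂) * Mfun ((u₂ + κ * u₁) / Real.sqrt (1 + κ ^ 2))
    - Real.sign u₁ * Real.sign (u₂ + κ * u₁)

/-- The point `−τ̄ + is` on the vertical ray from `−τ̄` to `i∞`. -/
def vray (τ : ℂ) (s : ℝ) : ℂ := -(starRingEnd ℂ) τ + Complex.I * s

/-- The double Eichler-type integral
`∫_{−τ̄}^{i∞} (−i(w₁+τ))^{−1/2} e^{iμw₁} ∫_{w₁}^{i∞} (−i(w₂+τ))^{−1/2} e^{iνw₂} dw₂ dw₁`,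
with `w₁ = −τ̄ + is₁`, `w₂ = w₁ + is₂`, `s₁, s₂ ∈ (0,∞)` (so `dw₂ dw₁ = i·i ds₂ ds₁`). -/
def Edub (μ ν : ℝ) (τ : ℂ) : ℂ :=
  Complex.I * Complex.I * ∫ s₁ in Set.Ioi (0:ℝ), ∫ s₂ in Set.Ioi (0:ℝ),
    (-Complex.I * (vray τ s₁ + τ)) ^ (-(1 : ℂ) / 2) * Complex.exp (Complex.I * μ * vray τ s₁) *
      ((-Complex.I * (vray τ s₁ + Complex.I * s₂ + τ)) ^ (-(1 : ℂ) / 2) *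
        Complex.exp (Complex.I * ν * (vray τ s₁ + Complex.I * s₂)))

lemma measurable_real_sign : Measurable Real.sign := by
  unfold Real.sign
  exact Measurable.ite measurableSet_Iio measurable_const
    (Measurable.ite measurableSet_Ioi measurable_const measurable_const)

lemma abs_real_sign_le_one (x : ℝ) : |Real.sign x| ≤ 1 := by
  rcases Real.sign_apply_eq x with h | h | h <;> simp [h]

lemma real_sign_mul_of_pos {t : ℝ} (ht : 0 < t) (x : ℝ) : Real.sign (t * x) = Real.sign x := by
  rcases lt_trichotomy x 0 with h | h | h
  · rw [Real.sign_of_neg h, Real.sign_of_neg (mul_neg_of_pos_of_neg ht h)]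
  · simp [h]
  · rw [Real.sign_of_pos h, Real.sign_of_pos (mul_pos ht h)]

lemma hasDerivAt_Efun (u : ℝ) : HasDerivAt Efun (2 * Real.exp (-Real.pi * u ^ 2)) u := by
  have hc : Continuous fun w : ℝ => Real.exp (-Real.pi * w ^ 2) := by fun_prop
  exact (hc.integral_hasStrictDerivAt 0 u).hasDerivAt.const_mul 2

lemma continuous_Efun : Continuous Efun :=
  continuous_iff_continuousAt.2 fun u => (hasDerivAt_Efun u).continuousAt

lemma Efun_zero : Efun 0 = 0 := by simp [Efun]

lemma Efun_neg (u : ℝ) : Efun (-u) = -Efun u := by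
  have h := intervalIntegral.integral_comp_neg (a := 0) (b := u)
    (fun w : ℝ => Real.exp (-Real.pi * w ^ 2))
  simp only [neg_sq, neg_zero] at h
  rw [Efun, Efun, h, intervalIntegral.integral_symm (-u) 0]
  ring

lemma integrable_gaussian_pi : Integrable fun w : ℝ => Real.exp (-Real.pi * w ^ 2) :=
  integrable_exp_neg_mul_sq Real.pi_pos

lemma tendsto_Efun_atTop : Tendsto Efun atTop (𝓝 1) := by
  have h := intervalIntegral_tendsto_integral_Ioi (0 : ℝ)
    integrable_gaussian_pi.integrableOn tendsto_id
  rw [integral_gaussian_Ioi, div_self Real.pi_ne_zero, Real.sqrt_one] at h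
  have h2 := h.const_mul 2
  rw [show (2 : ℝ) * (1 / 2) = 1 by norm_num] at h2
  exact h2

lemma tendsto_Efun_atBot : Tendsto Efun atBot (𝓝 (-1)) := by
  have h := (tendsto_Efun_atTop.comp tendsto_neg_atBot_atTop).neg
  refine h.congr fun u => ?_
  simp [Efun_neg]

lemma integrable_sign_mul {g : ℝ → ℝ} (hg : Integrable g) :
    Integrable fun w => Real.sign w * g w :=
  hg.bdd_mul (c := 1) measurable_real_sign.aestronglyMeasurable
    (Eventually.of_forall fun w => abs_real_sign_le_one w)

lemma integral_sign_mul_deriv {g g' : ℝ → ℝ} {m n : ℝ} (hderiv : ∀ x, HasDerivAt g (g' x) x)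
    (hInt : Integrable g') (hbot : Tendsto g atBot (𝓝 m)) (htop : Tendsto g atTop (𝓝 n)) :
    ∫ w, Real.sign w * g' w = m + n - 2 * g 0 := by
  have hs := integrable_sign_mul hInt
  rw [← intervalIntegral.integral_Iic_add_Ioi hs.integrableOn (b := 0) hs.integrableOn]
  have h1 : ∫ w in Set.Ioi (0 : ℝ), Real.sign w * g' w = n - g 0 := by
    rw [← integral_Ioi_of_hasDerivAt_of_tendsto' (fun x _ => hderiv x) hInt.integrableOn htop]
    refine setIntegral_congr_fun measurableSet_Ioi fun x hx => ?_
    simp [Real.sign_of_pos (Set.mem_Ioi.1 hx)]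
  have h2 : ∫ w in Set.Iic (0 : ℝ), Real.sign w * g' w = -(g 0 - m) := by
    rw [← integral_Iic_of_hasDerivAt_of_tendsto' (fun x _ => hderiv x) hInt.integrableOn hbot,
      integral_Iic_eq_integral_Iio, integral_Iic_eq_integral_Iio, ← integral_neg]
    refine setIntegral_congr_fun measurableSet_Iio fun x hx => ?_
    simp [Real.sign_of_neg (Set.mem_Iio.1 hx)]
  rw [h1, h2]
  ring

lemma integrable_gaussian_affine {s : ℝ} (hs : s ≠ 0) (u : ℝ) :
    Integrable fun w : ℝ => Real.exp (-Real.pi * (s * w - u) ^ 2) :=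
  (integrable_gaussian_pi.comp_sub_right u).comp_mul_left' hs

lemma integral_sign_mul_gaussian {s : ℝ} (hs : 0 < s) (u : ℝ) :
    ∫ w, Real.sign w * Real.exp (-Real.pi * (s * w - u) ^ 2) = Efun u / s := by
  have hd : ∀ x, HasDerivAt (fun w => Efun (s * w - u) / (2 * s))
      (Real.exp (-Real.pi * (s * x - u) ^ 2)) x := fun x => by
    have h := ((hasDerivAt_Efun (s * x - u)).comp x
      (((hasDerivAt_id x).const_mul s).sub_const u)).div_const (2 * s)
    refine h.congr_deriv ?_
    field_simp
  have htop : Tendsto (fun w => s * w - u) atTop atTop :=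
    tendsto_atTop_add_const_right _ (-u) (tendsto_id.const_mul_atTop hs)
  have hbot : Tendsto (fun w => s * w - u) atBot atBot :=
    tendsto_atBot_add_const_right _ (-u) (tendsto_id.const_mul_atBot hs)
  rw [integral_sign_mul_deriv hd (integrable_gaussian_affine hs.ne' u)
    ((tendsto_Efun_atBot.comp hbot).div_const (2 * s))
    ((tendsto_Efun_atTop.comp htop).div_const (2 * s))]
  simp only [mul_zero, zero_sub, Efun_neg]
  field_simp
  ring

lemma integral_sign_mul_gaussian_one (u : ℝ) :
    ∫ w, Real.sign w * Real.exp (-Real.pi * (w - u) ^ 2) = Efun u := by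
  simpa using integral_sign_mul_gaussian one_pos u

lemma abs_Efun_le_one (u : ℝ) : |Efun u| ≤ 1 := by
  have hInt := integrable_gaussian_pi.comp_sub_right u
  have h1 : ∫ w, Real.exp (-Real.pi * (w - u) ^ 2) = 1 := by
    rw [integral_sub_right_eq_self (fun w : ℝ => Real.exp (-Real.pi * w ^ 2)) u,
      integral_gaussian, div_self Real.pi_ne_zero, Real.sqrt_one]
  rw [← integral_sign_mul_gaussian_one u, ← h1]
  rw [← Real.norm_eq_abs]
  refine norm_integral_le_of_norm_le hInt (Eventually.of_forall fun w => ?_)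
  rw [norm_mul, Real.norm_eq_abs, Real.norm_eq_abs, Real.abs_exp]
  exact mul_le_of_le_one_left (Real.exp_pos _).le (abs_real_sign_le_one w)

lemma E2_eq_integral_Efun (κ u₁ u₂ : ℝ) :
    E2 κ u₁ u₂ =
      ∫ w, Real.sign w * Real.exp (-Real.pi * (w - u₁) ^ 2) * Efun (u₂ + κ * w) := by
  have hInt : Integrable (fun w : ℝ × ℝ => Real.sign w.1 * Real.sign (w.2 + κ * w.1) *
      Real.exp (-Real.pi * ((w.1 - u₁) ^ 2 + (w.2 - u₂) ^ 2))) := by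
    have hg := (integrable_gaussian_pi.comp_sub_right u₁).mul_prod
      (integrable_gaussian_pi.comp_sub_right u₂)
    have hm : Measurable fun w : ℝ × ℝ => Real.sign w.1 * Real.sign (w.2 + κ * w.1) :=
      (measurable_real_sign.comp measurable_fst).mul
        (measurable_real_sign.comp (measurable_snd.add (measurable_fst.const_mul κ)))
    refine (hg.bdd_mul (c := 1) hm.aestronglyMeasurable
      (Eventually.of_forall fun w => ?_)).congr (Eventually.of_forall fun w => ?_)
    · rw [norm_mul]
      exact mul_le_one₀ (abs_real_sign_le_one _) (norm_nonneg _) (abs_real_sign_le_one _)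
    · simp only [← Real.exp_add]
      ring_nf
  rw [E2, Measure.volume_eq_prod, integral_prod _ hInt]
  refine integral_congr_ae (Eventually.of_forall fun x => ?_)
  have h : ∀ y : ℝ, Real.sign x * Real.sign (y + κ * x) *
      Real.exp (-Real.pi * ((x - u₁) ^ 2 + (y - u₂) ^ 2)) =
      (Real.sign x * Real.exp (-Real.pi * (x - u₁) ^ 2)) *
        (Real.sign (y + κ * x) *
          Real.exp (-Real.pi * ((y + κ * x) - (u₂ + κ * x)) ^ 2)) := fun y => by
    rw [mul_add, Real.exp_add]
    ring_nf
  simp only [h]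
  rw [integral_const_mul, integral_add_right_eq_self
    (fun y : ℝ => Real.sign y * Real.exp (-Real.pi * (y - (u₂ + κ * x)) ^ 2)),
    integral_sign_mul_gaussian_one]

lemma integrable_gaussian_sub (u : ℝ) :
    Integrable fun w : ℝ => Real.exp (-Real.pi * (w - u) ^ 2) :=
  integrable_gaussian_pi.comp_sub_right u

lemma hasDerivAt_gaussian_mul_Efun (κ u v x : ℝ) :
    HasDerivAt (fun w => Real.exp (-Real.pi * (w - u) ^ 2) * Efun (v + κ * w))
      (-(2 * Real.pi) * ((x - u) * Real.exp (-Real.pi * (x - u) ^ 2) * Efun (v + κ * x)) +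
        2 * κ * (Real.exp (-Real.pi * (x - u) ^ 2) * Real.exp (-Real.pi * (v + κ * x) ^ 2))) x := by
  have h1 := ((((hasDerivAt_id x).sub_const u).pow 2).const_mul (-Real.pi)).exp
  have h2 := (hasDerivAt_Efun (v + κ * x)).comp x
    (((hasDerivAt_id x).const_mul κ).const_add v)
  refine (h1.mul h2).congr_deriv ?_
  simp
  ring

lemma integrable_mul_Efun {g : ℝ → ℝ} (hg : Integrable g) {f : ℝ → ℝ} (hf : Continuous f) :
    Integrable fun w => g w * Efun (f w) :=
  hg.mul_bdd (c := 1) (continuous_Efun.comp hf).aestronglyMeasurable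
    (Eventually.of_forall fun _ => abs_Efun_le_one _)

lemma integrable_gaussian_mul_gaussian (κ u v : ℝ) : Integrable fun w : ℝ =>
    Real.exp (-Real.pi * (w - u) ^ 2) * Real.exp (-Real.pi * (v + κ * w) ^ 2) :=
  (integrable_gaussian_sub u).mul_bdd (c := 1)
    (by fun_prop) (Eventually.of_forall fun _ => by
      rw [Real.norm_eq_abs, Real.abs_exp, Real.exp_le_one_iff, neg_mul, neg_nonpos]
      positivity)

lemma tendsto_gaussian_sub_mul_Efun {l : Filter ℝ} (κ u v : ℝ)
    (hl : Tendsto (fun w : ℝ => (w - u) ^ 2) l atTop) :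
    Tendsto (fun w => Real.exp (-Real.pi * (w - u) ^ 2) * Efun (v + κ * w)) l (𝓝 0) := by
  have h : Tendsto (fun w => Real.exp (-Real.pi * (w - u) ^ 2)) l (𝓝 0) :=
    Real.tendsto_exp_atBot.comp (hl.const_mul_atTop_of_neg (neg_lt_zero.2 Real.pi_pos))
  refine squeeze_zero_norm (fun w => ?_) h
  rw [norm_mul, Real.norm_eq_abs, Real.abs_exp]
  exact mul_le_of_le_one_right (Real.exp_pos _).le (abs_Efun_le_one _)

lemma integral_sign_mul_gaussian_mul_gaussian (κ a b t : ℝ) :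
    ∫ w, Real.sign w *
      (Real.exp (-Real.pi * (w - t * a) ^ 2) * Real.exp (-Real.pi * (t * b + κ * w) ^ 2)) =
    Real.exp (-Real.pi * (t * ((b + κ * a) / Real.sqrt (1 + κ ^ 2))) ^ 2) *
      Efun (t * ((a - κ * b) / Real.sqrt (1 + κ ^ 2))) / Real.sqrt (1 + κ ^ 2) := by
  have hpos : 0 < 1 + κ ^ 2 := by positivity
  have hr := Real.sqrt_pos.2 hpos
  have hsq := Real.sq_sqrt hpos.le
  set r := Real.sqrt (1 + κ ^ 2)
  rw [mul_div_assoc, ← integral_sign_mul_gaussian hr, ← integral_const_mul]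
  refine integral_congr_ae (Eventually.of_forall fun w => ?_)
  have h : Real.exp (-Real.pi * (w - t * a) ^ 2) * Real.exp (-Real.pi * (t * b + κ * w) ^ 2) =
      Real.exp (-Real.pi * (t * ((b + κ * a) / r)) ^ 2) *
        Real.exp (-Real.pi * (r * w - t * ((a - κ * b) / r)) ^ 2) := by
    rw [← Real.exp_add, ← Real.exp_add]
    congr 1
    have e1 : (r * w - t * ((a - κ * b) / r)) ^ 2 =
        r ^ 2 * w ^ 2 - 2 * t * (a - κ * b) * w + t ^ 2 * (a - κ * b) ^ 2 / r ^ 2 := by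
      field_simp
      ring
    rw [e1, mul_pow, div_pow, hsq]
    field_simp
    ring
  simp only [h]
  ring

lemma hasDerivAt_E2_ray (κ a b t : ℝ) :
    HasDerivAt (fun t => E2 κ (t * a) (t * b))
      (2 * a * (Real.exp (-Real.pi * (t * a) ^ 2) * Efun (t * b)) +
        2 * ((b + κ * a) / Real.sqrt (1 + κ ^ 2)) *
          (Real.exp (-Real.pi * (t * ((b + κ * a) / Real.sqrt (1 + κ ^ 2))) ^ 2) *
            Efun (t * ((a - κ * b) / Real.sqrt (1 + κ ^ 2))))) t := by
  simp only [E2_eq_integral_Efun]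
  set F' : ℝ → ℝ → ℝ := fun t w => Real.sign w *
    (2 * Real.pi * a * ((w - t * a) * Real.exp (-Real.pi * (w - t * a) ^ 2) *
        Efun (t * b + κ * w)) +
      2 * b * (Real.exp (-Real.pi * (w - t * a) ^ 2) *
        Real.exp (-Real.pi * (t * b + κ * w) ^ 2))) with hF'
  have hmul (u : ℝ) : Integrable fun w : ℝ => (w - u) * Real.exp (-Real.pi * (w - u) ^ 2) :=
    (integrable_mul_exp_neg_mul_sq Real.pi_pos).comp_sub_right u
  have hlin : Continuous fun w : ℝ => t * b + κ * w := by fun_prop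
  have hF (s : ℝ) : Integrable fun w : ℝ =>
      Real.sign w * Real.exp (-Real.pi * (w - s * a) ^ 2) * Efun (s * b + κ * w) :=
    integrable_mul_Efun (integrable_sign_mul (integrable_gaussian_sub _)) (by fun_prop)
  have hF'int : Integrable (F' t) :=
    integrable_sign_mul (((integrable_mul_Efun (hmul _) hlin).const_mul _).add
      ((integrable_gaussian_mul_gaussian κ (t * a) (t * b)).const_mul _))
  set R := (|t| + 1) * |a|
  set bound : ℝ → ℝ := fun w => Real.exp (Real.pi * R ^ 2) *
    (2 * Real.pi * |a| * (|w * Real.exp (-(Real.pi / 2) * w ^ 2)| +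
      R * Real.exp (-(Real.pi / 2) * w ^ 2)) + 2 * |b| * Real.exp (-(Real.pi / 2) * w ^ 2))
  have hbound_int : Integrable bound := by
    have hp : 0 < Real.pi / 2 := by positivity
    have hg := integrable_exp_neg_mul_sq hp
    exact ((((integrable_mul_exp_neg_mul_sq hp).norm.add (hg.const_mul R)).const_mul _).add
      (hg.const_mul _)).const_mul _
  have key := hasDerivAt_integral_of_dominated_loc_of_deriv_le (μ := volume)
    (F := fun s w => Real.sign w * Real.exp (-Real.pi * (w - s * a) ^ 2) * Efun (s * b + κ * w))
    (F' := F') (x₀ := t) (bound := bound) (Metric.ball_mem_nhds t one_pos)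
    (Eventually.of_forall fun s => (hF s).aestronglyMeasurable) (hF t)
    hF'int.aestronglyMeasurable (Eventually.of_forall fun w s hs => ?_) hbound_int
    (Eventually.of_forall fun w s _ => ?_)
  · refine key.2.congr_deriv ?_
    set g' : ℝ → ℝ := fun x =>
      -(2 * Real.pi) * ((x - t * a) * Real.exp (-Real.pi * (x - t * a) ^ 2) *
        Efun (t * b + κ * x)) +
      2 * κ * (Real.exp (-Real.pi * (x - t * a) ^ 2) * Real.exp (-Real.pi * (t * b + κ * x) ^ 2))
    have hg'int : Integrable g' :=
      ((integrable_mul_Efun (hmul _) hlin).const_mul _).add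
        ((integrable_gaussian_mul_gaussian κ (t * a) (t * b)).const_mul _)
    have hsub : Tendsto (fun w : ℝ => (w - t * a) ^ 2) atTop atTop :=
      (tendsto_pow_atTop two_ne_zero).comp
        (tendsto_atTop_add_const_right _ (-(t * a)) tendsto_id)
    have hsub' : Tendsto (fun w : ℝ => (w - t * a) ^ 2) atBot atTop := by
      have h := (tendsto_pow_atTop (α := ℝ) two_ne_zero).comp
        (tendsto_neg_atBot_atTop.comp (tendsto_atBot_add_const_right _ (-(t * a)) tendsto_id))
      refine h.congr fun w => ?_
      simp [sub_eq_add_neg]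
      ring
    have e1 := integral_sign_mul_deriv (hasDerivAt_gaussian_mul_Efun κ (t * a) (t * b)) hg'int
      (tendsto_gaussian_sub_mul_Efun κ _ _ hsub') (tendsto_gaussian_sub_mul_Efun κ _ _ hsub)
    have e2 := integral_sign_mul_gaussian_mul_gaussian κ a b t
    have e3 : F' t = fun w => -a * (Real.sign w * g' w) + 2 * (b + κ * a) * (Real.sign w *
        (Real.exp (-Real.pi * (w - t * a) ^ 2) * Real.exp (-Real.pi * (t * b + κ * w) ^ 2))) := by
      funext w
      simp only [hF', g']
      ring
    rw [e3, integral_add ((integrable_sign_mul hg'int).const_mul _)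
      ((integrable_sign_mul (integrable_gaussian_mul_gaussian _ _ _)).const_mul _),
      integral_const_mul, integral_const_mul, e1, e2]
    simp
    ring
  · have hs' : |s * a| ≤ R := by
      rw [abs_mul]
      refine mul_le_mul_of_nonneg_right ?_ (abs_nonneg a)
      have h1 : |s - t| < 1 := by simpa [Real.dist_eq] using hs
      have h2 := abs_sub_abs_le_abs_sub s t
      linarith
    have hR : (s * a) ^ 2 ≤ R ^ 2 := sq_le_sq' (by linarith [neg_abs_le (s * a)])
      ((le_abs_self _).trans hs')
    have hexp : Real.exp (-Real.pi * (w - s * a) ^ 2) ≤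
        Real.exp (Real.pi * R ^ 2) * Real.exp (-(Real.pi / 2) * w ^ 2) := by
      rw [← Real.exp_add, Real.exp_le_exp]
      nlinarith [mul_nonneg Real.pi_pos.le (sq_nonneg (w - 2 * (s * a))),
        mul_le_mul_of_nonneg_left hR Real.pi_pos.le]
    have hexp1 : Real.exp (-Real.pi * (s * b + κ * w) ^ 2) ≤ 1 := by
      rw [Real.exp_le_one_iff]
      nlinarith [Real.pi_pos, sq_nonneg (s * b + κ * w)]
    have hw : |w - s * a| ≤ |w| + R := (abs_sub _ _).trans (by linarith)
    have hR0 : 0 ≤ R := (abs_nonneg _).trans hs'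
    set G := Real.exp (-Real.pi * (w - s * a) ^ 2)
    set H := Real.exp (-(Real.pi / 2) * w ^ 2)
    have hG : 0 < G := Real.exp_pos _
    have hH : 0 < H := Real.exp_pos _
    have hpi := Real.pi_pos
    calc ‖F' s w‖ ≤ 1 * (2 * Real.pi * |a| * (|w - s * a| * G * |Efun (s * b + κ * w)|) +
          2 * |b| * (G * Real.exp (-Real.pi * (s * b + κ * w) ^ 2))) := by
          rw [hF', Real.norm_eq_abs, abs_mul]
          refine mul_le_mul (abs_real_sign_le_one w) ((abs_add_le _ _).trans (le_of_eq ?_))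
            (abs_nonneg _) zero_le_one
          simp only [abs_mul, abs_of_pos hpi, Real.abs_exp, abs_two]
          rfl
      _ ≤ 1 * (2 * Real.pi * |a| * ((|w| + R) * (Real.exp (Real.pi * R ^ 2) * H) * 1) +
          2 * |b| * ((Real.exp (Real.pi * R ^ 2) * H) * 1)) := by
          gcongr
          exact abs_Efun_le_one _
      _ = bound w := by
          simp only [bound, abs_mul, Real.abs_exp]
          ring
  · have h1 := (((((hasDerivAt_id s).mul_const a).const_sub w).pow 2).const_mul (-Real.pi)).exp
    have h2 := (hasDerivAt_Efun (s * b + κ * w)).comp s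
      (((hasDerivAt_id s).mul_const b).add_const (κ * w))
    refine ((h1.const_mul (Real.sign w)).mul h2).congr_deriv ?_
    simp [hF']
    ring

lemma tendsto_Efun_mul_add {c : ℝ} (hc : c ≠ 0) (d : ℝ) :
    Tendsto (fun t => Efun (t * c + d)) atTop (𝓝 (Real.sign c)) := by
  rcases hc.lt_or_gt with h | h
  · rw [Real.sign_of_neg h]
    exact tendsto_Efun_atBot.comp
      (tendsto_atBot_add_const_right _ d (tendsto_id.atTop_mul_const_of_neg h))
  · rw [Real.sign_of_pos h]
    exact tendsto_Efun_atTop.comp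
      (tendsto_atTop_add_const_right _ d (tendsto_id.atTop_mul_const h))

lemma tendsto_sign_add_mul {a : ℝ} (ha : a ≠ 0) (x : ℝ) :
    Tendsto (fun t => Real.sign (x + t * a)) atTop (𝓝 (Real.sign a)) := by
  refine tendsto_const_nhds.congr' ?_
  rcases ha.lt_or_gt with h | h
  · filter_upwards [(tendsto_atBot_add_const_left _ x
      (tendsto_id.atTop_mul_const_of_neg h)).eventually_lt_atBot 0] with t ht
    rw [Real.sign_of_neg h]
    exact (Real.sign_of_neg ht).symm
  · filter_upwards [(tendsto_atTop_add_const_left _ x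
      (tendsto_id.atTop_mul_const h)).eventually_gt_atTop 0] with t ht
    rw [Real.sign_of_pos h]
    exact (Real.sign_of_pos ht).symm

lemma tendsto_E2_ray {κ a b : ℝ} (ha : a ≠ 0) (hc : b + κ * a ≠ 0) :
    Tendsto (fun t => E2 κ (t * a) (t * b)) atTop
      (𝓝 (Real.sign a * Real.sign (b + κ * a))) := by
  have e (t : ℝ) : E2 κ (t * a) (t * b) = ∫ x, Real.sign (x + t * a) *
      Real.exp (-Real.pi * x ^ 2) * Efun (t * (b + κ * a) + κ * x) := by
    rw [E2_eq_integral_Efun, ← integral_add_right_eq_self _ (t * a)]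
    refine integral_congr_ae (Eventually.of_forall fun x => ?_)
    simp only [add_sub_cancel_right]
    ring_nf
  have hlim : ∫ x, Real.sign a * Real.exp (-Real.pi * x ^ 2) * Real.sign (b + κ * a) =
      Real.sign a * Real.sign (b + κ * a) := by
    rw [integral_mul_const, integral_const_mul, integral_gaussian, div_self Real.pi_ne_zero,
      Real.sqrt_one, mul_one]
  simp only [e]
  rw [← hlim]
  refine tendsto_integral_filter_of_dominated_convergence
    (fun x => Real.exp (-Real.pi * x ^ 2)) (Eventually.of_forall fun t => ?_)
    (Eventually.of_forall fun t => Eventually.of_forall fun x => ?_) integrable_gaussian_pi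
    (Eventually.of_forall fun x => ?_)
  · have h1 : Measurable fun x => Real.sign (x + t * a) :=
      measurable_real_sign.comp (measurable_id.add_const _)
    have h2 : Measurable fun x => Efun (t * (b + κ * a) + κ * x) :=
      continuous_Efun.measurable.comp (by fun_prop)
    have h3 : Measurable fun x : ℝ => Real.exp (-Real.pi * x ^ 2) := by fun_prop
    exact ((h1.mul h3).mul h2).aestronglyMeasurable
  · rw [Real.norm_eq_abs, abs_mul, abs_mul, Real.abs_exp]
    exact (mul_le_of_le_one_right (by positivity) (abs_Efun_le_one _)).trans
      (mul_le_of_le_one_left (Real.exp_pos _).le (abs_real_sign_le_one _))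
  · exact ((tendsto_sign_add_mul ha x).mul_const _).mul (tendsto_Efun_mul_add hc _)

lemma continuous_Mfun_ray {b : ℝ} : ContinuousOn (fun t => Mfun (t * b)) (Set.Ioi 0) := by
  have h : ContinuousOn (fun t => Efun (t * b) - Real.sign b) (Set.Ioi 0) :=
    ((continuous_Efun.comp (continuous_mul_const b)).sub continuous_const).continuousOn
  exact h.congr fun t ht => by rw [Mfun, real_sign_mul_of_pos ht]

lemma abs_Mfun_le_two (u : ℝ) : |Mfun u| ≤ 2 :=
  (abs_sub _ _).trans (by linarith [abs_Efun_le_one u, abs_real_sign_le_one u])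

lemma tendsto_Mfun_ray {b : ℝ} (hb : b ≠ 0) : Tendsto (fun t => Mfun (t * b)) atTop (𝓝 0) := by
  have h := (tendsto_Efun_mul_add hb 0).sub_const (Real.sign b)
  rw [sub_self] at h
  refine h.congr' ?_
  filter_upwards [eventually_gt_atTop 0] with t ht
  rw [Mfun, real_sign_mul_of_pos ht, add_zero]

lemma M2_ray {κ a b t : ℝ} (ht : 0 < t) :
    M2 κ (t * a) (t * b) = E2 κ (t * a) (t * b) - Real.sign b * Mfun (t * a)
      - Real.sign (a - κ * b) * Mfun (t * ((b + κ * a) / Real.sqrt (1 + κ ^ 2)))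
      - Real.sign a * Real.sign (b + κ * a) := by
  rw [M2, real_sign_mul_of_pos ht, real_sign_mul_of_pos ht,
    show t * a - κ * (t * b) = t * (a - κ * b) by ring,
    show t * b + κ * (t * a) = t * (b + κ * a) by ring,
    real_sign_mul_of_pos ht, real_sign_mul_of_pos ht, mul_div_assoc]

lemma tendsto_M2_ray {κ a b : ℝ} (ha : a ≠ 0) (hc : b + κ * a ≠ 0) :
    Tendsto (fun t => M2 κ (t * a) (t * b)) atTop (𝓝 0) := by
  have hr : Real.sqrt (1 + κ ^ 2) ≠ 0 := (Real.sqrt_pos.2 (by positivity)).ne'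
  have h := (((tendsto_E2_ray ha hc).sub ((tendsto_Mfun_ray ha).const_mul (Real.sign b))).sub
    ((tendsto_Mfun_ray (div_ne_zero hc hr)).const_mul (Real.sign (a - κ * b)))).sub_const
    (Real.sign a * Real.sign (b + κ * a))
  simp only [mul_zero, sub_zero, sub_self] at h
  refine h.congr' ?_
  filter_upwards [eventually_gt_atTop 0] with t ht
  rw [M2_ray ht]

lemma hasDerivAt_Mfun_ray {b t : ℝ} (ht : 0 < t) :
    HasDerivAt (fun t => Mfun (t * b)) (2 * b * Real.exp (-Real.pi * (t * b) ^ 2)) t := by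
  have h := ((hasDerivAt_Efun (t * b)).comp t ((hasDerivAt_id t).mul_const b)).sub_const
    (Real.sign b)
  refine (h.congr_of_eventuallyEq ?_).congr_deriv (by ring)
  filter_upwards [eventually_gt_nhds ht] with s hs
  simp [Mfun, real_sign_mul_of_pos hs]

lemma hasDerivAt_M2_ray {κ a b t : ℝ} (ht : 0 < t) :
    HasDerivAt (fun t => M2 κ (t * a) (t * b))
      (2 * a * (Real.exp (-Real.pi * (t * a) ^ 2) * Mfun (t * b)) +
        2 * ((b + κ * a) / Real.sqrt (1 + κ ^ 2)) *
          (Real.exp (-Real.pi * (t * ((b + κ * a) / Real.sqrt (1 + κ ^ 2))) ^ 2) *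
            Mfun (t * ((a - κ * b) / Real.sqrt (1 + κ ^ 2))))) t := by
  have h := (((hasDerivAt_E2_ray κ a b t).sub
    ((hasDerivAt_Mfun_ray (b := a) ht).const_mul (Real.sign b))).sub
    ((hasDerivAt_Mfun_ray (b := (b + κ * a) / Real.sqrt (1 + κ ^ 2)) ht).const_mul
      (Real.sign (a - κ * b)))).sub_const (Real.sign a * Real.sign (b + κ * a))
  have hr : 0 < Real.sqrt (1 + κ ^ 2) := Real.sqrt_pos.2 (by positivity)
  have hs : Real.sign ((a - κ * b) / Real.sqrt (1 + κ ^ 2)) = Real.sign (a - κ * b) := by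
    rw [div_eq_inv_mul, real_sign_mul_of_pos (inv_pos.2 hr)]
  refine (h.congr_of_eventuallyEq ?_).congr_deriv ?_
  · filter_upwards [eventually_gt_nhds ht] with s hs
    rw [M2_ray hs]
    rfl
  · rw [Mfun, Mfun, real_sign_mul_of_pos ht, real_sign_mul_of_pos ht, hs]
    ring

/-- The double integral `∫∫ y₁^{-1/2} e^{-πa²y₁} y₂^{-1/2} e^{-πb²y₂}` over `c < y₁ < y₂`. -/
def gaussDouble (c a b : ℝ) : ℝ :=
  ∫ s₁ in Set.Ioi (0 : ℝ), ∫ s₂ in Set.Ioi (0 : ℝ),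
    (Real.sqrt (c + s₁))⁻¹ * Real.exp (-Real.pi * a ^ 2 * (c + s₁)) *
      ((Real.sqrt (c + s₁ + s₂))⁻¹ * Real.exp (-Real.pi * b ^ 2 * (c + s₁ + s₂)))

lemma hasDerivAt_sqrt_add {c s : ℝ} (hc : 0 < c + s) :
    HasDerivAt (fun s => Real.sqrt (c + s)) (1 / (2 * Real.sqrt (c + s))) s :=
  ((hasDerivAt_id s).const_add c).sqrt hc.ne'

lemma tendsto_sqrt_add (c : ℝ) : Tendsto (fun s => Real.sqrt (c + s)) atTop atTop :=
  Real.tendsto_sqrt_atTop.comp (tendsto_atTop_add_const_left _ c tendsto_id)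

lemma hasDerivAt_Mfun_sqrt_add {y b s : ℝ} (hp : 0 < y + s) (hb : b ≠ 0) :
    HasDerivAt (fun s => Mfun (Real.sqrt (y + s) * b) / b)
      ((Real.sqrt (y + s))⁻¹ * Real.exp (-Real.pi * b ^ 2 * (y + s))) s := by
  have h := ((hasDerivAt_Mfun_ray (b := b) (Real.sqrt_pos.2 hp)).comp s
    (hasDerivAt_sqrt_add hp)).div_const b
  refine h.congr_deriv ?_
  rw [mul_pow, Real.sq_sqrt hp.le]
  have := (Real.sqrt_pos.2 hp).ne'
  field_simp

lemma integral_sqrt_inv_mul_exp {y b : ℝ} (hy : 0 < y) (hb : b ≠ 0) :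
    ∫ s in Set.Ioi (0 : ℝ), (Real.sqrt (y + s))⁻¹ * Real.exp (-Real.pi * b ^ 2 * (y + s)) =
      -Mfun (Real.sqrt y * b) / b := by
  have hpos (s : ℝ) (hs : 0 ≤ s) : 0 < y + s := by linarith
  have hlim := ((tendsto_Mfun_ray hb).comp (tendsto_sqrt_add y)).div_const b
  rw [integral_Ioi_of_hasDerivAt_of_nonneg'
    (fun s hs => hasDerivAt_Mfun_sqrt_add (hpos s hs) hb) (fun s _ => by positivity) hlim]
  simp
  ring

lemma integrableOn_gaussian_mul_Mfun {c a : ℝ} (b : ℝ) (hc : 0 < c) (ha : a ≠ 0) :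
    IntegrableOn (fun s => (Real.sqrt (c + s))⁻¹ * Real.exp (-Real.pi * a ^ 2 * (c + s)) *
      Mfun (Real.sqrt (c + s) * b)) (Set.Ioi 0) := by
  have hpos (s : ℝ) (hs : 0 ≤ s) : 0 < c + s := by linarith
  have hsq (s : ℝ) (hs : s ∈ Set.Ioi (0 : ℝ)) : 0 < Real.sqrt (c + s) :=
    Real.sqrt_pos.2 (hpos s (le_of_lt hs))
  have hlim := ((tendsto_Mfun_ray ha).comp (tendsto_sqrt_add c)).div_const a
  have hInt := integrableOn_Ioi_deriv_of_nonneg'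
    (fun s hs => hasDerivAt_Mfun_sqrt_add (hpos s hs) ha) (fun s _ => by positivity) hlim
  refine Integrable.mul_bdd (c := 2) hInt ?_ (Eventually.of_forall fun s => abs_Mfun_le_two _)
  refine ContinuousOn.aestronglyMeasurable ?_ measurableSet_Ioi
  exact continuous_Mfun_ray.comp (by fun_prop) hsq

lemma gaussDouble_eq {c a b : ℝ} (hc : 0 < c) (hb : b ≠ 0) :
    gaussDouble c a b = -(∫ s in Set.Ioi (0 : ℝ), (Real.sqrt (c + s))⁻¹ *
      Real.exp (-Real.pi * a ^ 2 * (c + s)) * Mfun (Real.sqrt (c + s) * b)) / b := by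
  rw [gaussDouble, ← integral_neg, ← integral_div]
  refine setIntegral_congr_fun measurableSet_Ioi fun s hs => ?_
  have hp : 0 < c + s := by linarith [Set.mem_Ioi.1 hs]
  rw [integral_const_mul, integral_sqrt_inv_mul_exp hp hb]
  ring

theorem M2_eq_gaussDouble {κ a b c : ℝ} (hc : 0 < c) (ha : a ≠ 0) (hb : b ≠ 0)
    (ha' : b + κ * a ≠ 0) (hb' : a - κ * b ≠ 0) :
    M2 κ (Real.sqrt c * a) (Real.sqrt c * b) = a * b * gaussDouble c a b +
      (b + κ * a) / Real.sqrt (1 + κ ^ 2) * ((a - κ * b) / Real.sqrt (1 + κ ^ 2)) *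
        gaussDouble c ((b + κ * a) / Real.sqrt (1 + κ ^ 2))
          ((a - κ * b) / Real.sqrt (1 + κ ^ 2)) := by
  have hr : Real.sqrt (1 + κ ^ 2) ≠ 0 := (Real.sqrt_pos.2 (by positivity)).ne'
  have hd : ∀ s ∈ Set.Ici (0 : ℝ), HasDerivAt
      (fun s => M2 κ (Real.sqrt (c + s) * a) (Real.sqrt (c + s) * b))
      (a * ((Real.sqrt (c + s))⁻¹ * Real.exp (-Real.pi * a ^ 2 * (c + s)) *
          Mfun (Real.sqrt (c + s) * b)) +
        (b + κ * a) / Real.sqrt (1 + κ ^ 2) * ((Real.sqrt (c + s))⁻¹ *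
          Real.exp (-Real.pi * ((b + κ * a) / Real.sqrt (1 + κ ^ 2)) ^ 2 * (c + s)) *
          Mfun (Real.sqrt (c + s) * ((a - κ * b) / Real.sqrt (1 + κ ^ 2))))) s := fun s hs => by
    have hp : 0 < c + s := by linarith [Set.mem_Ici.1 hs]
    have h := (hasDerivAt_M2_ray (κ := κ) (a := a) (b := b) (Real.sqrt_pos.2 hp)).comp s
      (hasDerivAt_sqrt_add hp)
    refine h.congr_deriv ?_
    have e (x : ℝ) : -Real.pi * (Real.sqrt (c + s) * x) ^ 2 = -Real.pi * x ^ 2 * (c + s) := by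
      rw [mul_pow, Real.sq_sqrt hp.le]
      ring
    rw [e, e]
    ring
  have i1 := (integrableOn_gaussian_mul_Mfun b hc ha).const_mul a
  have i2 := (integrableOn_gaussian_mul_Mfun ((a - κ * b) / Real.sqrt (1 + κ ^ 2)) hc
    (div_ne_zero ha' hr)).const_mul ((b + κ * a) / Real.sqrt (1 + κ ^ 2))
  have h := integral_Ioi_of_hasDerivAt_of_tendsto' hd (i1.add i2)
    ((tendsto_M2_ray ha ha').comp (tendsto_sqrt_add c))
  rw [integral_add i1 i2, integral_const_mul, integral_const_mul, add_zero, zero_sub] at h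
  have hb'' := div_ne_zero hb' hr
  rw [gaussDouble_eq hc hb, gaussDouble_eq hc hb'', ← neg_eq_iff_eq_neg.2 h, mul_assoc,
    mul_div_cancel₀ _ hb, mul_assoc, mul_div_cancel₀ _ hb'']
  ring

lemma vray_add_self (τ : ℂ) (s : ℝ) :
    -Complex.I * (vray τ s + τ) = ((2 * τ.im + s : ℝ) : ℂ) := by
  apply Complex.ext <;> simp [vray]
  ring

lemma ofReal_cpow_neg_half {x : ℝ} (hx : 0 < x) :
    (x : ℂ) ^ (-(1 : ℂ) / 2) = ((Real.sqrt x)⁻¹ : ℝ) := by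
  rw [show (-(1 : ℂ) / 2) = ((-(1 / 2) : ℝ) : ℂ) by push_cast; ring, ← Complex.ofReal_cpow hx.le,
    Real.rpow_neg hx.le, Real.sqrt_eq_rpow]

lemma exp_mul_Edub {τ : ℂ} (hτ : 0 < τ.im) (a b q : ℝ) (hq : a ^ 2 + b ^ 2 = 2 * q) :
    Complex.exp (2 * Real.pi * Complex.I * τ * q) *
      Edub (Real.pi * a ^ 2) (Real.pi * b ^ 2) τ = -(gaussDouble (2 * τ.im) a b : ℂ) := by
  rw [Edub, ← mul_assoc, mul_comm (Complex.exp _), Complex.I_mul_I, gaussDouble, mul_assoc,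
    neg_one_mul, ← integral_const_mul, ← integral_complex_ofReal]
  congr 1
  refine setIntegral_congr_fun measurableSet_Ioi fun s hs => ?_
  rw [← integral_const_mul, ← integral_complex_ofReal]
  refine setIntegral_congr_fun measurableSet_Ioi fun r hr => ?_
  have hs' : 0 < 2 * τ.im + s := by linarith [Set.mem_Ioi.1 hs]
  have hr' : 0 < 2 * τ.im + s + r := by linarith [Set.mem_Ioi.1 hr]
  have e2 : -Complex.I * (vray τ s + Complex.I * r + τ) = ((2 * τ.im + s + r : ℝ) : ℂ) := by
    have h := vray_add_self τ s
    push_cast at h ⊢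
    linear_combination h - r * Complex.I_sq
  rw [vray_add_self, e2, ofReal_cpow_neg_half hs', ofReal_cpow_neg_half hr']
  have e3 : Complex.exp (2 * Real.pi * Complex.I * τ * q) *
      (Complex.exp (Complex.I * (Real.pi * a ^ 2 : ℝ) * vray τ s) *
        Complex.exp (Complex.I * (Real.pi * b ^ 2 : ℝ) * (vray τ s + Complex.I * r))) =
      ((Real.exp (-Real.pi * a ^ 2 * (2 * τ.im + s)) *
        Real.exp (-Real.pi * b ^ 2 * (2 * τ.im + s + r)) : ℝ) : ℂ) := by
    have h := vray_add_self τ s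
    have hq' : (a : ℂ) ^ 2 + (b : ℂ) ^ 2 = 2 * q := by exact_mod_cast hq
    push_cast at e2 h ⊢
    rw [← Complex.exp_add, ← Complex.exp_add, ← Complex.exp_add]
    congr 1
    rw [← e2, ← h]
    linear_combination -(Real.pi * Complex.I * τ) * hq'
  push_cast at e3 ⊢
  linear_combination ((Real.sqrt (2 * τ.im + s) : ℂ)⁻¹ * (Real.sqrt (2 * τ.im + s + r) : ℂ)⁻¹) * e3

/-- Equation (6.1)/(M2id) of the paper: `M₂(√3; √(3v)(2n₁+n₂), √v·n₂)` as a combination of two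
double Eichler-type integrals. -/
theorem M2_as_double_Eichler (τ : ℂ) (hτ : 0 < τ.im) (n₁ n₂ : ℝ)
    (h₁ : n₁ ≠ 0) (h₂ : n₂ ≠ 0) (h₃ : 2 * n₁ + n₂ ≠ 0) (h₄ : 3 * n₁ + 2 * n₂ ≠ 0) :
    (M2 (Real.sqrt 3) (Real.sqrt (3 * τ.im) * (2 * n₁ + n₂)) (Real.sqrt τ.im * n₂) : ℂ) =
      -((Real.sqrt 3 / 2 * ((2 * n₁ + n₂) * n₂) : ℝ) : ℂ) *
          Complex.exp (2 * Real.pi * Complex.I * τ * (Qf n₁ n₂ : ℝ)) *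
          Edub (3 * Real.pi / 2 * (2 * n₁ + n₂) ^ 2) (Real.pi / 2 * n₂ ^ 2) τ
        - ((Real.sqrt 3 / 2 * ((3 * n₁ + 2 * n₂) * n₁) : ℝ) : ℂ) *
            Complex.exp (2 * Real.pi * Complex.I * τ * (Qf n₁ n₂ : ℝ)) *
            Edub (Real.pi / 2 * (3 * n₁ + 2 * n₂) ^ 2) (3 * Real.pi / 2 * n₁ ^ 2) τ := by
  have hs3 : Real.sqrt 3 ^ 2 = 3 := Real.sq_sqrt (by norm_num)
  have hs2 : Real.sqrt 2 ^ 2 = 2 := Real.sq_sqrt (by norm_num)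
  have p3 : 0 < Real.sqrt 3 := Real.sqrt_pos.2 (by norm_num)
  have p2 : 0 < Real.sqrt 2 := Real.sqrt_pos.2 (by norm_num)
  have hv : Real.sqrt (2 * τ.im) = Real.sqrt 2 * Real.sqrt τ.im := Real.sqrt_mul (by norm_num) _
  have hv3 : Real.sqrt (3 * τ.im) = Real.sqrt 3 * Real.sqrt τ.im := Real.sqrt_mul (by norm_num) _
  have hr : Real.sqrt (1 + Real.sqrt 3 ^ 2) = 2 := by
    rw [hs3, show (1 : ℝ) + 3 = 2 ^ 2 by norm_num, Real.sqrt_sq (by norm_num)]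
  set a := Real.sqrt 3 * (2 * n₁ + n₂) / Real.sqrt 2 with ha
  set b := n₂ / Real.sqrt 2 with hb
  have hca : b + Real.sqrt 3 * a = 2 * ((3 * n₁ + 2 * n₂) / Real.sqrt 2) := by
    rw [ha, hb]
    field_simp
    linear_combination (2 * n₁ + n₂) * hs3
  have hcb : a - Real.sqrt 3 * b = 2 * (Real.sqrt 3 * n₁ / Real.sqrt 2) := by
    rw [ha, hb]
    field_simp
    ring
  have key := M2_eq_gaussDouble (κ := Real.sqrt 3) (a := a) (b := b) (c := 2 * τ.im)
    (by positivity) (by positivity) (by positivity) (by rw [hca]; positivity)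
    (by rw [hcb]; positivity)
  rw [hr, hca, hcb, mul_div_cancel_left₀ _ two_ne_zero, mul_div_cancel_left₀ _ two_ne_zero,
    show Real.sqrt (2 * τ.im) * a = Real.sqrt (3 * τ.im) * (2 * n₁ + n₂) by
      rw [hv, hv3, ha]; field_simp,
    show Real.sqrt (2 * τ.im) * b = Real.sqrt τ.im * n₂ by rw [hv, hb]; field_simp] at key
  set a' := (3 * n₁ + 2 * n₂) / Real.sqrt 2 with ha'
  set b' := Real.sqrt 3 * n₁ / Real.sqrt 2 with hb'
  have sa : a ^ 2 = 3 / 2 * (2 * n₁ + n₂) ^ 2 := by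
    rw [ha, div_pow, mul_pow, hs3, hs2]; ring
  have sb : b ^ 2 = n₂ ^ 2 / 2 := by rw [hb, div_pow, hs2]
  have sa' : a' ^ 2 = (3 * n₁ + 2 * n₂) ^ 2 / 2 := by rw [ha', div_pow, hs2]
  have sb' : b' ^ 2 = 3 / 2 * n₁ ^ 2 := by
    rw [hb', div_pow, mul_pow, hs3, hs2]; ring
  have k1 := exp_mul_Edub hτ a b (Qf n₁ n₂) (by rw [sa, sb, Qf]; ring)
  have k2 := exp_mul_Edub hτ a' b' (Qf n₁ n₂) (by rw [sa', sb', Qf]; ring)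
  have pab : a * b = Real.sqrt 3 / 2 * ((2 * n₁ + n₂) * n₂) := by
    rw [ha, hb, div_mul_div_comm, ← sq, hs2]; ring
  have pab' : a' * b' = Real.sqrt 3 / 2 * ((3 * n₁ + 2 * n₂) * n₁) := by
    rw [ha', hb', div_mul_div_comm, ← sq, hs2]; ring
  rw [show 3 * Real.pi / 2 * (2 * n₁ + n₂) ^ 2 = Real.pi * a ^ 2 by rw [sa]; ring,
    show Real.pi / 2 * n₂ ^ 2 = Real.pi * b ^ 2 by rw [sb]; ring,
    show Real.pi / 2 * (3 * n₁ + 2 * n₂) ^ 2 = Real.pi * a' ^ 2 by rw [sa']; ring,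
    show 3 * Real.pi / 2 * n₁ ^ 2 = Real.pi * b' ^ 2 by rw [sb']; ring,
    key, ← pab, ← pab']
  push_cast
  linear_combination (a * b : ℂ) * k1 + (a' * b' : ℂ) * k2

end
end
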